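/- arXiv:2005.05470 — 2 statements merged into one kernel-verified Lean document; each statement's English description precedes it below -/
import Mathlib

section
/- (Quasi-Weierstrass normal form.) Let d ≥ 1 and let A, B be d×d complex matrices such that the pencil A − λB is regular, i.e. det(A + λ₀B) ≠ 0 for some λ₀ ∈ ℂ. Then there exist an integer m with 0 ≤ m ≤ d, invertible d×d complex matrices F and G, a matrix L ∈ ℂ^{m×m}, a nilpotent matrix N ∈ ℂ^{(d−m)×(d−m)}, and an identification of ℂ^d with ℂ^m × ℂ^{d−m} (a bijective reindexing of coordinates), such that A = F · blockdiag(L, 𝟙_{d−m}) · G and B = F · blockdiag(𝟙_m, N) · G. -/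
open Matrix

/-- Fitting decomposition of an endomorphism: the space splits into two invariant subspaces, on
the first of which the endomorphism is invertible and on the second of which it is nilpotent. -/
theorem LinearMap.exists_isCompl_isUnit_restrict_isNilpotent_restrict
    {K V : Type*} [Field K] [AddCommGroup V] [Module K V] [FiniteDimensional K V]
    (f : Module.End K V) :
    ∃ (p q : Submodule K V) (_ : IsCompl p q) (hp : ∀ x ∈ p, f x ∈ p) (hq : ∀ x ∈ q, f x ∈ q),
      IsUnit (f.restrict hp : Module.End K p) ∧ IsNilpotent (f.restrict hq : Module.End K q) := by
  obtain ⟨k, hk, hk1⟩ := (f.eventually_isCompl_ker_pow_range_pow.and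
    (Filter.eventually_ge_atTop 1)).exists
  have hcomm (x : V) : f ((f ^ k) x) = (f ^ k) (f x) := by
    rw [← Module.End.mul_apply, ← Module.End.mul_apply, (Commute.self_pow f k).eq]
  have hp : ∀ x ∈ range (f ^ k), f x ∈ range (f ^ k) := by
    rintro _ ⟨y, rfl⟩
    exact ⟨f y, (hcomm y).symm⟩
  have hq : ∀ x ∈ ker (f ^ k), f x ∈ ker (f ^ k) := by
    intro x hx
    rw [mem_ker] at hx ⊢
    rw [← hcomm, hx, map_zero]
  refine ⟨range (f ^ k), ker (f ^ k), hk.symm, hp, hq, ?_, k, ?_⟩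
  · rw [LinearMap.isUnit_iff_ker_eq_bot, LinearMap.ker_eq_bot']
    rintro ⟨x, hx⟩ h
    have hfx : f x = 0 := congrArg Subtype.val h
    have hxk : x ∈ ker (f ^ k) := by
      obtain ⟨j, rfl⟩ := Nat.exists_eq_add_of_le' hk1
      rw [mem_ker, pow_succ, Module.End.mul_apply, hfx, map_zero]
    exact Subtype.ext (Submodule.disjoint_def.mp hk.disjoint x hxk hx)
  · rw [Module.End.pow_restrict]
    ext ⟨x, hx⟩
    exact hx

/-- Fitting decomposition of a square matrix: it is similar to a block diagonal matrix with an
invertible block and a nilpotent block. -/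
theorem Matrix.exists_eq_conj_reindex_fromBlocks {K : Type*} [Field K] {d : ℕ}
    (M : Matrix (Fin d) (Fin d) K) :
    ∃ (m : ℕ) (_ : m ≤ d) (e : Fin m ⊕ Fin (d - m) ≃ Fin d) (P Q : Matrix (Fin d) (Fin d) K)
      (J : Matrix (Fin m) (Fin m) K) (N : Matrix (Fin (d - m)) (Fin (d - m)) K),
      P * Q = 1 ∧ IsUnit J ∧ IsNilpotent N ∧
      M = P * reindex e e (fromBlocks J 0 0 N) * Q := by
  obtain ⟨p, q, h, hp, hq, hJ, hN⟩ :=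
    LinearMap.exists_isCompl_isUnit_restrict_isNilpotent_restrict (toLin' M)
  have hdim := Submodule.finrank_add_eq_of_isCompl h
  rw [Module.finrank_fin_fun] at hdim
  have hm : Module.finrank K p ≤ d := by omega
  let e : Fin (Module.finrank K p) ⊕ Fin (d - Module.finrank K p) ≃ Fin d :=
    finSumFinEquiv.trans (finCongr (by omega))
  let bp := Module.finBasis K p
  let bq := Module.finBasisOfFinrankEq K q (n := d - Module.finrank K p) (by omega)
  let φ := Submodule.prodEquivOfIsCompl p q h
  let b := ((bp.prod bq).map φ).reindex e
  let s := Pi.basisFun K (Fin d)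
  have hφ (x : p × q) : φ.symm (toLin' M (φ x)) =
      ((toLin' M).restrict hp).prodMap ((toLin' M).restrict hq) x := by
    rw [LinearEquiv.symm_apply_eq]
    simp [φ, mulVec_add]
  have hblock : LinearMap.toMatrix b b (toLin' M) = reindex e e (fromBlocks
      (LinearMap.toMatrix bp bp ((toLin' M).restrict hp)) 0 0
      (LinearMap.toMatrix bq bq ((toLin' M).restrict hq))) := by
    rw [← LinearMap.toMatrix_prodMap]
    ext i j
    simp only [LinearMap.toMatrix_apply, b, reindex_apply, submatrix_apply,
      Module.Basis.reindex_apply, Module.Basis.map_apply, Module.Basis.repr_reindex_apply,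
      Module.Basis.map_repr, LinearEquiv.trans_apply, hφ]
  refine ⟨_, hm, e, s.toMatrix b, b.toMatrix s,
    LinearMap.toMatrix bp bp ((toLin' M).restrict hp),
    LinearMap.toMatrix bq bq ((toLin' M).restrict hq),
    s.toMatrix_mul_toMatrix_flip b, ?_, ?_, ?_⟩
  · exact hJ.map (LinearMap.toMatrixAlgEquiv bp)
  · exact hN.map (LinearMap.toMatrixAlgEquiv bq)
  · rw [← hblock, basis_toMatrix_mul_linearMap_toMatrix_mul_basis_toMatrix]
    exact (LinearMap.toMatrix'_toLin' M).symm

/-- Quasi-Weierstrass normal form: a regular pencil `A - λ B` can be written as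
`A = F · blockdiag(L, 𝟙) · G`, `B = F · blockdiag(𝟙, N) · G` with `F, G` invertible
and `N` nilpotent, the block decomposition being realized by an equivalence
`Fin m ⊕ Fin (d - m) ≃ Fin d`. -/
theorem quasi_weierstrass_normal_form
    (d : ℕ) (hd : 1 ≤ d) (A B : Matrix (Fin d) (Fin d) ℂ)
    (hreg : ∃ lam : ℂ, (A + lam • B).det ≠ 0) :
    ∃ (m : ℕ) (_ : m ≤ d) (e : Fin m ⊕ Fin (d - m) ≃ Fin d)
      (F G : Matrix (Fin d) (Fin d) ℂ) (_ : IsUnit F) (_ : IsUnit G)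
      (L : Matrix (Fin m) (Fin m) ℂ)
      (N : Matrix (Fin (d - m)) (Fin (d - m)) ℂ) (_ : IsNilpotent N),
      A = F * (Matrix.reindex e e (Matrix.fromBlocks L 0 0 (1 : Matrix (Fin (d - m)) (Fin (d - m)) ℂ))) * G ∧
      B = F * (Matrix.reindex e e (Matrix.fromBlocks (1 : Matrix (Fin m) (Fin m) ℂ) 0 0 N)) * G := by
  obtain ⟨lam, hlam⟩ := hreg
  set C := A + lam • B with hC
  have hCu : IsUnit C.det := hlam.isUnit
  obtain ⟨m, hm, e, P, Q, J, N, hPQ, hJ, hN, hM⟩ :=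
    exists_eq_conj_reindex_fromBlocks (C⁻¹ * B)
  have hQP : Q * P = 1 := mul_eq_one_comm.mp hPQ
  have hB : B = C * P * reindexAlgEquiv ℂ ℂ e (fromBlocks J 0 0 N) * Q := by
    rw [← mul_nonsing_inv_cancel_left C B hCu, hM]
    simp [mul_assoc]
  have hA : A = C * P * reindexAlgEquiv ℂ ℂ e
      (fromBlocks (1 - lam • J) 0 0 (1 - lam • N)) * Q := by
    have hblock : fromBlocks (1 - lam • J) 0 0 (1 - lam • N) =
        1 - lam • fromBlocks J 0 0 N := by
      rw [← fromBlocks_one, fromBlocks_smul, sub_eq_add_neg (fromBlocks _ _ _ _), fromBlocks_neg,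
        fromBlocks_add]
      simp [sub_eq_add_neg]
    rw [hblock, map_sub, map_one, map_smul, mul_sub, sub_mul, mul_one, mul_assoc C P Q, hPQ,
      mul_one, mul_smul_comm, smul_mul_assoc, ← hB, hC, add_sub_cancel_right]
  have hU : IsUnit (1 - lam • N) := (hN.smul lam).isUnit_one_sub
  obtain ⟨U, hU⟩ := hU
  obtain ⟨J, rfl⟩ := hJ
  have hD : IsUnit (fromBlocks (J : Matrix (Fin m) (Fin m) ℂ) 0 0
      (U : Matrix (Fin (d - m)) (Fin (d - m)) ℂ)) :=
    isUnit_fromBlocks_zero₂₁.mpr ⟨J.isUnit, U.isUnit⟩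
  have hUN : Commute (↑U⁻¹ : Matrix (Fin (d - m)) (Fin (d - m)) ℂ) N := by
    refine Commute.units_inv_left ?_
    rw [hU]
    exact (Commute.one_left N).sub_left ((Commute.refl N).smul_left lam)
  refine ⟨m, hm, e, C * P * reindexAlgEquiv ℂ ℂ e (fromBlocks J 0 0 U), Q,
    (((isUnit_iff_isUnit_det C).mpr hCu).mul (.of_mul_eq_one Q hPQ)).mul
      (hD.map (reindexAlgEquiv ℂ ℂ e)), .of_mul_eq_one P hQP,
    J⁻¹.val * (1 - lam • (J : Matrix (Fin m) (Fin m) ℂ)), U⁻¹.val * N, hUN.isNilpotent_mul_left hN,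
    ?_, ?_⟩
  · rw [← coe_reindexAlgEquiv ℂ ℂ, mul_assoc (C * P), ← map_mul, fromBlocks_multiply]
    simpa [← hU] using hA
  · rw [← coe_reindexAlgEquiv ℂ ℂ, mul_assoc (C * P), ← map_mul, fromBlocks_multiply]
    simpa using hB
end

section
/- Let d ≥ 1, 0 ≤ m ≤ d, let F and G be invertible d×d complex matrices, L an m×m complex matrix, N a nilpotent (d−m)×(d−m) complex matrix, and set A := F·blockdiag(L, 𝟙_{d−m})·G, B := F·blockdiag(𝟙_m, N)·G. Then for every k ∈ ℂ, the matrix A + ikB is invertible if and only if L + ik𝟙_m is invertible, i.e. if and only if k ∉ {i·l : l an eigenvalue of L}. In particular, the set {k ∈ ℂ : A + ikB is not invertible} has at most m elements. -/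
open Matrix

theorem Matrix.ncard_spectrum_le {n K : Type*} [Fintype n] [DecidableEq n] [Field K]
    (M : Matrix n n K) : (spectrum K M).ncard ≤ Fintype.card n := by
  classical
  have h : spectrum K M ⊆ (M.charpoly.roots.toFinset : Set K) := by
    intro x hx
    simpa [M.charpoly_monic.ne_zero] using Matrix.mem_spectrum_iff_isRoot_charpoly.mp hx
  calc (spectrum K M).ncard ≤ M.charpoly.roots.toFinset.card := by
        simpa only [Set.ncard_coe_finset] using Set.ncard_le_ncard h (Finset.finite_toSet _)
    _ ≤ Multiset.card M.charpoly.roots := Multiset.toFinset_card_le _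
    _ ≤ M.charpoly.natDegree := Polynomial.card_roots' _
    _ = Fintype.card n := M.charpoly_natDegree_eq_dim

/-- For a pencil in quasi-Weierstrass normal form `A = F·blockdiag(L,𝟙)·G`,
`B = F·blockdiag(𝟙,N)·G` (`F`, `G` invertible, `N` nilpotent), `A + ikB` is invertible iff
`L + ik𝟙` is invertible, iff `k` is not of the form `i·l` with `l ∈ σ(L)`; in particular
the singular set has at most `m` elements. -/
theorem singular_points_of_quasi_weierstrass_pencil
    (d m : ℕ) (hd : 1 ≤ d) (hm : m ≤ d)
    (F G : Matrix (Fin d) (Fin d) ℂ) (hF : IsUnit F) (hG : IsUnit G)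
    (L : Matrix (Fin m) (Fin m) ℂ)
    (N : Matrix (Fin (d - m)) (Fin (d - m)) ℂ) (hN : IsNilpotent N)
    (e : Fin m ⊕ Fin (d - m) ≃ Fin d)
    (A B : Matrix (Fin d) (Fin d) ℂ)
    (hA : A = F * (Matrix.reindex e e (Matrix.fromBlocks L 0 0
      (1 : Matrix (Fin (d - m)) (Fin (d - m)) ℂ))) * G)
    (hB : B = F * (Matrix.reindex e e (Matrix.fromBlocks
      (1 : Matrix (Fin m) (Fin m) ℂ) 0 0 N)) * G) :
    (∀ k : ℂ, IsUnit (A + (Complex.I * k) • B) ↔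
      IsUnit (L + (Complex.I * k) • (1 : Matrix (Fin m) (Fin m) ℂ))) ∧
    (∀ k : ℂ, IsUnit (A + (Complex.I * k) • B) ↔
      ∀ l ∈ spectrum ℂ L, k ≠ Complex.I * l) ∧
    {k : ℂ | ¬ IsUnit (A + (Complex.I * k) • B)}.Finite ∧
    {k : ℂ | ¬ IsUnit (A + (Complex.I * k) • B)}.ncard ≤ m := by
  have unit_iff (k : ℂ) : IsUnit (A + (Complex.I * k) • B) ↔
      IsUnit (L + (Complex.I * k) • (1 : Matrix (Fin m) (Fin m) ℂ)) := by
    have factor : A + (Complex.I * k) • B =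
        F * reindexAlgEquiv ℂ ℂ e (fromBlocks (L + (Complex.I * k) • 1) 0 0
          (1 + (Complex.I * k) • N)) * G := by
      have blocks : fromBlocks (L + (Complex.I * k) • 1) 0 0 (1 + (Complex.I * k) • N) =
          fromBlocks L 0 0 1 + (Complex.I * k) • fromBlocks 1 0 0 N := by
        simp [fromBlocks_smul, fromBlocks_add]
      rw [blocks, map_add, map_smul, hA, hB]
      simp only [coe_reindexAlgEquiv, mul_add, add_mul, Matrix.mul_smul, Matrix.smul_mul]
    have hN' : IsUnit (1 + (Complex.I * k) • N) := (hN.smul _).isUnit_one_add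
    rw [factor, hG.mul_right_iff, hF.mul_left_iff, isUnit_map_iff,
      isUnit_fromBlocks_zero₂₁, and_iff_left hN']
  have mem_iff (k : ℂ) : ¬ IsUnit (A + (Complex.I * k) • B) ↔
      -(Complex.I * k) ∈ spectrum ℂ L := by
    rw [unit_iff, spectrum.mem_iff, Algebra.algebraMap_eq_smul_one, ← IsUnit.neg_iff]
    congr! 2
    rw [neg_smul]
    abel
  have rotate (k l : ℂ) : k = Complex.I * l ↔ -(Complex.I * k) = l := by
    constructor
    · rintro rfl
      linear_combination -l * Complex.I_mul_I
    · rintro rfl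
      linear_combination k * Complex.I_mul_I
  have set_eq : {k : ℂ | ¬ IsUnit (A + (Complex.I * k) • B)} =
      (Complex.I * ·) '' spectrum ℂ L := by
    ext k
    simp only [Set.mem_ofPred_eq, mem_iff, Set.mem_image, eq_comm (b := k), rotate,
      exists_eq_right']
  have spectrum_finite : (spectrum ℂ L).Finite := L.finite_spectrum
  refine ⟨unit_iff, fun k ↦ ?_, set_eq ▸ spectrum_finite.image _, ?_⟩
  · rw [← not_iff_not, mem_iff]
    simp [rotate]
  · rw [set_eq]
    simpa using (Set.ncard_image_le spectrum_finite).trans L.ncard_spectrum_le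
end
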